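/- arXiv:1508.05891 — 3 statements merged into one kernel-verified Lean document; each statement's English description precedes it below -/
import Mathlib

section
/- Let n ≥ 2 and let w : Fin n → ℝ be nonzero with Σ_{c} w(c) = 0. Then the range of the linear map T_w : ℝ^{Perm(Fin n)} → ℝ^{Fin n} is exactly the space {f : Fin n → ℝ | Σ_c f(c) = 0} of functions summing to zero; in particular T_w has rank n − 1. -/
/-- The positional voting map `T_w`, sending a profile `p : Perm (Fin n) → ℝ` to the
score function `c ↦ ∑ σ, p σ * w (σ⁻¹ c)`. -/
noncomputable def posMap (n : ℕ) (w : Fin n → ℝ) :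
    (Equiv.Perm (Fin n) → ℝ) →ₗ[ℝ] (Fin n → ℝ) where
  toFun p := fun c => ∑ σ : Equiv.Perm (Fin n), p σ * w (σ⁻¹ c)
  map_add' p q := by
    funext c
    simp [add_mul, Finset.sum_add_distrib]
  map_smul' a p := by
    funext c
    simp [Finset.mul_sum, mul_assoc]

/-- The subspace of functions on candidates whose values sum to zero. -/
def zeroSum (n : ℕ) : Submodule ℝ (Fin n → ℝ) where
  carrier := {f | ∑ c : Fin n, f c = 0}
  add_mem' := by
    intro a b ha hb
    simp only [Set.mem_setOf_eq, Pi.add_apply, Finset.sum_add_distrib] at *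
    rw [ha, hb, add_zero]
  zero_mem' := by simp
  smul_mem' := by
    intro a f hf
    simp only [Set.mem_setOf_eq, Pi.smul_apply, smul_eq_mul, ← Finset.mul_sum] at *
    rw [hf, mul_zero]

theorem mem_zeroSum {n : ℕ} {f : Fin n → ℝ} : f ∈ zeroSum n ↔ ∑ c, f c = 0 := Iff.rfl

theorem posMap_apply {n : ℕ} (w : Fin n → ℝ) (p : Equiv.Perm (Fin n) → ℝ) (c : Fin n) :
    posMap n w p c = ∑ σ : Equiv.Perm (Fin n), p σ * w (σ⁻¹ c) := rfl

theorem posMap_single {n : ℕ} (w : Fin n → ℝ) (σ : Equiv.Perm (Fin n)) :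
    posMap n w (Pi.single σ 1) = fun c => w (σ⁻¹ c) := by
  funext c
  simp [posMap_apply, Pi.single_apply]

theorem range_posMap_le_zeroSum {n : ℕ} {w : Fin n → ℝ} (hw : ∑ c, w c = 0) :
    LinearMap.range (posMap n w) ≤ zeroSum n := by
  rintro _ ⟨p, rfl⟩
  simp only [mem_zeroSum, posMap_apply]
  rw [Finset.sum_comm]
  refine Finset.sum_eq_zero fun σ _ => ?_
  rw [← Finset.mul_sum, Equiv.sum_comp σ⁻¹ w, hw, mul_zero]

theorem exists_perm_apply_eq_apply_eq {α : Type*} [DecidableEq α] {a b i j : α}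
    (hab : a ≠ b) (hij : i ≠ j) : ∃ τ : Equiv.Perm α, τ a = i ∧ τ b = j := by
  refine ⟨Equiv.swap (Equiv.swap a i b) j * Equiv.swap a i, ?_, by simp⟩
  have h : i ≠ Equiv.swap a i b := fun h => hab <| (Equiv.swap a i).injective (by simpa using h)
  simp [Equiv.swap_apply_of_ne_of_ne h hij]

/-- Two rankings that differ by exchanging positions `a` and `b` have score functions
differing by a multiple of `e_i - e_j`. -/
theorem single_sub_single_mem_range_posMap {n : ℕ} {w : Fin n → ℝ} {a b : Fin n}
    (hab : w a ≠ w b) (i j : Fin n) :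
    (Pi.single i 1 - Pi.single j 1 : Fin n → ℝ) ∈ LinearMap.range (posMap n w) := by
  obtain rfl | hij := eq_or_ne i j
  · simp
  have hne : a ≠ b := fun h => hab (h ▸ rfl)
  obtain ⟨τ, rfl, rfl⟩ := exists_perm_apply_eq_apply_eq hne hij
  refine ⟨(w a - w b)⁻¹ • (Pi.single τ 1 - Pi.single (τ * Equiv.swap a b) 1), ?_⟩
  rw [map_smul, map_sub, posMap_single, posMap_single,
    inv_smul_eq_iff₀ (sub_ne_zero.mpr hab)]
  funext c
  obtain ⟨x, rfl⟩ := τ.surjective c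
  by_cases hxa : x = a
  · subst hxa
    simp [hne]
  by_cases hxb : x = b
  · subst hxb
    simp [hxa]
  simp [hxa, hxb, Equiv.swap_apply_of_ne_of_ne hxa hxb]

theorem exists_apply_ne_of_sum_eq_zero {n : ℕ} {w : Fin n → ℝ} (hw0 : w ≠ 0)
    (hw : ∑ c, w c = 0) : ∃ a b, w a ≠ w b := by
  by_contra! h
  refine hw0 (funext fun a => ?_)
  have : NeZero n := ⟨fun h0 => (h0 ▸ a).elim0⟩
  simpa [h _ a, NeZero.ne n] using hw

theorem zeroSum_le_range_posMap {n : ℕ} {w : Fin n → ℝ} (hw0 : w ≠ 0)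
    (hw : ∑ c, w c = 0) : zeroSum n ≤ LinearMap.range (posMap n w) := by
  intro f hf
  obtain ⟨a, b, hab⟩ := exists_apply_ne_of_sum_eq_zero hw0 hw
  have hsum : f = ∑ i, f i • (Pi.single i 1 - Pi.single a 1 : Fin n → ℝ) := by
    simp only [smul_sub, Finset.sum_sub_distrib, ← Finset.sum_smul]
    rw [mem_zeroSum.mp hf, zero_smul, sub_zero]
    exact pi_eq_sum_univ' f
  rw [hsum]
  exact Submodule.sum_mem _ fun i _ =>
    Submodule.smul_mem _ _ (single_sub_single_mem_range_posMap hab i a)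

theorem finrank_zeroSum {n : ℕ} (hn : 0 < n) : Module.finrank ℝ (zeroSum n) = n - 1 := by
  let φ : Module.Dual ℝ (Fin n → ℝ) := ∑ c, LinearMap.proj c
  have hφ : ∀ f, φ f = ∑ c, f c := fun f => by simp [φ]
  have hker : zeroSum n = LinearMap.ker φ := by
    ext f
    rw [mem_zeroSum, LinearMap.mem_ker, hφ]
  have hne : φ ≠ 0 := fun h => by
    have := hφ (Pi.single ⟨0, hn⟩ 1)
    simp [h] at this
  have := Module.Dual.finrank_ker_add_one_of_ne_zero hne
  rw [Module.finrank_fin_fun] at this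
  rw [hker]
  lia

/-- If w : Fin n → ℝ is nonzero and sums to zero (n ≥ 2), then the range
of T_w is exactly the space of functions summing to zero, and T_w has rank n − 1. -/
theorem range_posMap_eq_zeroSum (n : ℕ) (hn : 2 ≤ n)
    (w : Fin n → ℝ) (hw0 : w ≠ 0) (hwsum : ∑ c, w c = 0) :
    LinearMap.range (posMap n w) = zeroSum n ∧
    Module.finrank ℝ (LinearMap.range (posMap n w)) = n - 1 := by
  have h : LinearMap.range (posMap n w) = zeroSum n :=
    le_antisymm (range_posMap_le_zeroSum hwsum) (zeroSum_le_range_posMap hw0 hwsum)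
  exact ⟨h, h ▸ finrank_zeroSum (by lia)⟩
end

section
/- Let n ≥ 3, let b : Fin n → ℝ be the Borda weighting vector b(r) = n − 1 − r, and let B = T_b* ∘ T_b : ℝ^{Perm(Fin n)} → ℝ^{Perm(Fin n)}, i.e., B(p)(τ) = Σ_{c ∈ Fin n} T_b(p)(c)·b(τ⁻¹(c)). Then B is self-adjoint, and its eigenvalues are exactly β₀ = (n−1)·(n!/2)·C(n,2), β₁ = n·(n+1)!/12, and 0, with eigenspaces of dimensions 1, n−1, and n! − n, respectively. -/
/-- The Borda weight of position r: `n − 1 − r`. -/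
def bordaWeight (n : ℕ) (r : Fin n) : ℝ := (n : ℝ) - 1 - (r.val : ℝ)

/-- The operator `B = T_b* ∘ T_b`, i.e. `B(p)(τ) = Σ_c T_b(p)(c) · b(τ⁻¹ c)` where `b`
is the Borda weighting vector. -/
noncomputable def bordaOp (n : ℕ) :
    (Equiv.Perm (Fin n) → ℝ) →ₗ[ℝ] (Equiv.Perm (Fin n) → ℝ) where
  toFun p := fun τ =>
    ∑ c : Fin n,
      (∑ σ : Equiv.Perm (Fin n), p σ * bordaWeight n (σ⁻¹ c)) * bordaWeight n (τ⁻¹ c)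
  map_add' p q := by
    funext τ
    simp [add_mul, Finset.sum_add_distrib]
  map_smul' a p := by
    funext τ
    simp [Finset.mul_sum, Finset.sum_mul, mul_assoc]

open Module in
/-- For `μ ≠ 0`, the `μ`-eigenspaces of `g ∘ f` and `f ∘ g` have the same dimension. -/
theorem finrank_eigenspace_comp_comm {K V W : Type*} [Field K] [AddCommGroup V] [Module K V]
    [AddCommGroup W] [Module K W] (f : V →ₗ[K] W) (g : W →ₗ[K] V) {μ : K} (hμ : μ ≠ 0) :
    finrank K (End.eigenspace (g ∘ₗ f : End K V) μ) =
      finrank K (End.eigenspace (f ∘ₗ g : End K W) μ) := by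
  have hf : ∀ x ∈ End.eigenspace (g ∘ₗ f : End K V) μ,
      f x ∈ End.eigenspace (f ∘ₗ g : End K W) μ := fun x hx => by
    rw [End.mem_eigenspace_iff, LinearMap.comp_apply] at hx ⊢
    rw [hx, map_smul]
  have hg : ∀ y ∈ End.eigenspace (f ∘ₗ g : End K W) μ,
      μ⁻¹ • g y ∈ End.eigenspace (g ∘ₗ f : End K V) μ := fun y hy => by
    rw [End.mem_eigenspace_iff, LinearMap.comp_apply] at hy ⊢
    rw [map_smul, map_smul, hy, map_smul, smul_comm]
  refine LinearEquiv.finrank_eq (LinearEquiv.ofLinearMap (f.restrict hf)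
    ((μ⁻¹ • g).restrict hg) ?_ ?_)
  · ext ⟨y, hy⟩
    rw [End.mem_eigenspace_iff, LinearMap.comp_apply] at hy
    simp [LinearMap.restrict_apply, hy, smul_smul, hμ]
  · ext ⟨x, hx⟩
    rw [End.mem_eigenspace_iff, LinearMap.comp_apply] at hx
    simp [LinearMap.restrict_apply, hx, smul_smul, hμ]

/-- The matrix of the Borda positional voting map. -/
def bordaMatrix (n : ℕ) : Matrix (Fin n) (Equiv.Perm (Fin n)) ℝ :=
  Matrix.of fun c σ => bordaWeight n (σ⁻¹ c)

theorem bordaOp_eq_comp (n : ℕ) :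
    bordaOp n = (bordaMatrix n).transpose.mulVecLin ∘ₗ (bordaMatrix n).mulVecLin := by
  refine LinearMap.ext fun p => funext fun τ => ?_
  simp only [LinearMap.comp_apply, Matrix.mulVecLin_apply]
  simp [bordaOp, bordaMatrix, Matrix.mulVec, dotProduct, mul_comm]

theorem sum_bordaWeight (n : ℕ) : ∑ r, bordaWeight n r = (n : ℝ) * (n - 1) / 2 := by
  have h (m : ℕ) (a : ℝ) : ∑ i ∈ Finset.range m, (a - i) = m * a - m * (m - 1) / 2 := by
    induction m with
    | zero => simp
    | succ k ih => rw [Finset.sum_range_succ, ih]; push_cast; ring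
  simp only [bordaWeight]
  rw [Fin.sum_univ_eq_sum_range (fun i : ℕ => (n : ℝ) - 1 - i), h]
  ring

theorem sum_bordaWeight_sq (n : ℕ) :
    ∑ r, bordaWeight n r ^ 2 = (n : ℝ) * (n - 1) * (2 * n - 1) / 6 := by
  have h (m : ℕ) (a : ℝ) : ∑ i ∈ Finset.range m, (a - i) ^ 2 =
      m * a ^ 2 - a * (m * (m - 1)) + m * (m - 1) * (2 * m - 1) / 6 := by
    induction m with
    | zero => simp
    | succ k ih => rw [Finset.sum_range_succ, ih]; push_cast; ring
  simp only [bordaWeight]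
  rw [Fin.sum_univ_eq_sum_range (fun i : ℕ => ((n : ℝ) - 1 - i) ^ 2), h]
  ring

/-- The Gram matrix of the rows of a positional voting matrix is invariant under relabelling
the candidates. -/
theorem bordaGram_smul {n : ℕ} (π : Equiv.Perm (Fin n)) (c d : Fin n) :
    (bordaMatrix n * (bordaMatrix n).transpose) (π c) (π d) =
      (bordaMatrix n * (bordaMatrix n).transpose) c d := by
  simp only [Matrix.mul_apply, Matrix.transpose_apply, bordaMatrix, Matrix.of_apply]
  refine Fintype.sum_equiv (Equiv.mulLeft π⁻¹) _ _ fun σ => ?_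
  simp

theorem bordaGram_diag {n : ℕ} (c : Fin n) :
    n * (bordaMatrix n * (bordaMatrix n).transpose) c c =
      n.factorial * ((n : ℝ) * (n - 1) * (2 * n - 1) / 6) := by
  have h : ∑ d, (bordaMatrix n * (bordaMatrix n).transpose) d d =
      n.factorial * ((n : ℝ) * (n - 1) * (2 * n - 1) / 6) := by
    simp only [Matrix.mul_apply, Matrix.transpose_apply, bordaMatrix, Matrix.of_apply, ← pow_two]
    rw [Finset.sum_comm]
    simp only [fun σ : Equiv.Perm (Fin n) => Equiv.sum_comp σ⁻¹ (fun r => bordaWeight n r ^ 2),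
      sum_bordaWeight_sq]
    simp [Fintype.card_perm]
  have h' (d : Fin n) : (bordaMatrix n * (bordaMatrix n).transpose) d d =
      (bordaMatrix n * (bordaMatrix n).transpose) c c := by
    simpa using bordaGram_smul (Equiv.swap c d) c c
  simpa [h'] using h

theorem sum_sum_bordaGram (n : ℕ) :
    ∑ c, ∑ d, (bordaMatrix n * (bordaMatrix n).transpose) c d =
      n.factorial * ((n : ℝ) * (n - 1) / 2) ^ 2 := by
  simp only [Matrix.mul_apply, Matrix.transpose_apply, bordaMatrix, Matrix.of_apply]
  calc _ = ∑ c, ∑ σ : Equiv.Perm (Fin n), ∑ d, bordaWeight n (σ⁻¹ c) * bordaWeight n (σ⁻¹ d) :=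
        Finset.sum_congr rfl fun c _ => Finset.sum_comm
    _ = ∑ σ : Equiv.Perm (Fin n), ∑ c, ∑ d, bordaWeight n (σ⁻¹ c) * bordaWeight n (σ⁻¹ d) :=
        Finset.sum_comm
    _ = ∑ σ : Equiv.Perm (Fin n), ((n : ℝ) * (n - 1) / 2) ^ 2 := by
        refine Finset.sum_congr rfl fun σ _ => ?_
        rw [← Finset.sum_mul_sum, Equiv.sum_comp σ⁻¹ (bordaWeight n), sum_bordaWeight, pow_two]
    _ = _ := by simp [Fintype.card_perm]

theorem bordaGram_offDiag_eq {n : ℕ} {c d c' d' : Fin n} (h : c ≠ d) (h' : c' ≠ d') :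
    (bordaMatrix n * (bordaMatrix n).transpose) c d =
      (bordaMatrix n * (bordaMatrix n).transpose) c' d' := by
  obtain ⟨π, rfl, rfl⟩ := (MulAction.is_two_pretransitive_iff
    (G := Equiv.Perm (Fin n)) (α := Fin n)).1
    (Equiv.Perm.isMultiplyPretransitive _ 2) h h'
  exact (bordaGram_smul π c d).symm

/-- `T_b ∘ T_b*` is a combination of the identity and the all-ones matrix. -/
theorem bordaGram_mulVec {n : ℕ} (hn : 2 ≤ n) (v : Fin n → ℝ) (c : Fin n) :
    ((bordaMatrix n * (bordaMatrix n).transpose).mulVec v) c =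
      (n : ℝ) * ((n + 1).factorial : ℝ) / 12 * v c +
      (((n : ℝ) - 1) * ((n.factorial : ℝ) / 2) * (n.choose 2 : ℝ) -
        (n : ℝ) * ((n + 1).factorial : ℝ) / 12) / n * ∑ d, v d := by
  set G := bordaMatrix n * (bordaMatrix n).transpose with hG
  have : NeZero n := ⟨by omega⟩
  have hn2 : (2 : ℝ) ≤ n := by exact_mod_cast hn
  have hn0 : (n : ℝ) ≠ 0 := by positivity
  have hn1 : (n : ℝ) - 1 ≠ 0 := by linarith
  let i : Fin n := ⟨0, by omega⟩
  let j : Fin n := ⟨1, by omega⟩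
  have hij : i ≠ j := by simp [i, j]
  have hent (a b : Fin n) : G a b = (G i i - G i j) * (if a = b then 1 else 0) + G i j := by
    split_ifs with h
    · subst h
      have := (bordaGram_diag a).trans (bordaGram_diag i).symm
      rw [← hG] at this
      rw [mul_left_cancel₀ hn0 this]; ring
    · rw [hG, bordaGram_offDiag_eq h hij]; ring
  have hdiag := bordaGram_diag i
  rw [← hG] at hdiag
  have hsum : n * (G i i - G i j) + n * n * G i j =
      n.factorial * ((n : ℝ) * (n - 1) / 2) ^ 2 := by
    rw [← sum_sum_bordaGram n, ← hG]
    rw [Finset.sum_congr rfl fun c _ => Finset.sum_congr rfl fun d _ => hent c d]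
    simp [Finset.sum_add_distrib]
    ring
  have hA : G i i = n.factorial * (((n : ℝ) - 1) * (2 * n - 1) / 6) := by
    apply mul_left_cancel₀ hn0
    rw [hdiag]; ring
  have hD : G i j = n.factorial * ((n : ℝ) * (n - 1) / 4 - (2 * n - 1) / 6) := by
    apply mul_left_cancel₀ (mul_ne_zero hn0 hn1)
    rw [hA] at hsum
    linear_combination hsum
  have hv : G.mulVec v c = (G i i - G i j) * v c + G i j * ∑ d, v d := by
    simp only [Matrix.mulVec, dotProduct]
    rw [Finset.sum_congr rfl fun d _ => congrArg (· * v d) (hent c d)]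
    simp [add_mul, Finset.sum_add_distrib, Finset.mul_sum]
  rw [hv, hA, hD, Nat.cast_choose_two, Nat.factorial_succ]
  push_cast
  field_simp
  ring

open Module in
theorem finrank_eigenspace_const_add_sum {n : ℕ} (hn : 1 ≤ n) (L : End ℝ (Fin n → ℝ)) {a b : ℝ}
    (hab : a ≠ b) (hL : ∀ v c, L v c = b * v c + (a - b) / n * ∑ d, v d) :
    finrank ℝ (End.eigenspace L a) = 1 ∧ finrank ℝ (End.eigenspace L b) = n - 1 := by
  have : NeZero n := ⟨by omega⟩
  have hn0 : (n : ℝ) ≠ 0 := by exact_mod_cast NeZero.ne n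
  have hab' : a - b ≠ 0 := sub_ne_zero.2 hab
  constructor
  · have h : End.eigenspace L a = ℝ ∙ (fun _ => 1 : Fin n → ℝ) := by
      ext v
      rw [End.mem_eigenspace_iff, Submodule.mem_span_singleton]
      constructor
      · intro hv
        refine ⟨(∑ d, v d) / n, funext fun c => ?_⟩
        have := (hL v c).symm.trans (congrFun hv c)
        simp only [Pi.smul_apply, smul_eq_mul] at this ⊢
        apply mul_left_cancel₀ hab'
        linear_combination this
      · rintro ⟨t, rfl⟩
        funext c
        rw [hL]
        simp
        field_simp
        ring
    rw [h, finrank_span_singleton]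
    exact fun h => one_ne_zero (congrFun h 0)
  · let s : (Fin n → ℝ) →ₗ[ℝ] ℝ := ∑ d, LinearMap.proj d
    have hs (v) : s v = ∑ d, v d := by simp [s]
    have h : End.eigenspace L b = LinearMap.ker s := by
      ext v
      rw [End.mem_eigenspace_iff, LinearMap.mem_ker, hs]
      constructor
      · intro hv
        have := (hL v 0).symm.trans (congrFun hv 0)
        simpa [hab', hn0] using this
      · intro hv
        funext c
        rw [hL, hv]
        simp
    have hr : LinearMap.range s = ⊤ := LinearMap.range_eq_top.2 fun t =>
      ⟨Pi.single 0 t, by simp [hs]⟩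
    have := s.finrank_range_add_finrank_ker
    rw [hr, finrank_top, finrank_self, finrank_fin_fun] at this
    rw [h]
    omega

theorem eq_zero_of_const_add_sum {n : ℕ} (hn : 1 ≤ n) {a b μ : ℝ} {v : Fin n → ℝ}
    (hv : ∀ c, b * v c + (a - b) / n * ∑ d, v d = μ * v c) (ha : μ ≠ a) (hb : μ ≠ b) :
    v = 0 := by
  have hn0 : (n : ℝ) ≠ 0 := by positivity
  have hs : ∑ d, v d = 0 := by
    have h := Finset.sum_congr (rfl : (Finset.univ : Finset (Fin n)) = _) fun c _ => hv c
    rw [Finset.sum_add_distrib, ← Finset.mul_sum] at h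
    simp only [Finset.sum_const, Finset.card_univ, Fintype.card_fin, nsmul_eq_mul] at h
    rw [← Finset.mul_sum] at h
    field_simp at h
    apply mul_left_cancel₀ (sub_ne_zero.2 ha)
    linear_combination -h
  funext c
  have := hv c
  rw [hs] at this
  apply mul_left_cancel₀ (sub_ne_zero.2 hb)
  simp only [Pi.zero_apply]
  linear_combination -this

/-- For n ≥ 3, the operator B = T_b* ∘ T_b is self-adjoint with respect
to the standard inner product, its eigenvalues are exactly β₀ = (n−1)·(n!/2)·C(n,2),
β₁ = n·(n+1)!/12 and 0, with eigenspaces of dimensions 1, n−1 and n! − n. -/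
theorem bordaOp_selfAdjoint_and_spectrum (n : ℕ) (hn : 3 ≤ n) :
    (∀ p q : Equiv.Perm (Fin n) → ℝ,
      ∑ τ : Equiv.Perm (Fin n), bordaOp n p τ * q τ =
        ∑ τ : Equiv.Perm (Fin n), p τ * bordaOp n q τ)
    ∧ (∀ μ : ℝ, Module.End.HasEigenvalue (bordaOp n) μ ↔
        (μ = ((n : ℝ) - 1) * ((n.factorial : ℝ) / 2) * (n.choose 2 : ℝ) ∨
         μ = (n : ℝ) * ((n + 1).factorial : ℝ) / 12 ∨
         μ = 0))
    ∧ Module.finrank ℝ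
        (Module.End.eigenspace (bordaOp n)
          (((n : ℝ) - 1) * ((n.factorial : ℝ) / 2) * (n.choose 2 : ℝ))) = 1
    ∧ Module.finrank ℝ
        (Module.End.eigenspace (bordaOp n) ((n : ℝ) * ((n + 1).factorial : ℝ) / 12)) = n - 1
    ∧ Module.finrank ℝ
        (Module.End.eigenspace (bordaOp n) (0 : ℝ)) = n.factorial - n := by
  have hn3 : (3 : ℝ) ≤ n := by exact_mod_cast hn
  set a : ℝ := ((n : ℝ) - 1) * ((n.factorial : ℝ) / 2) * (n.choose 2 : ℝ) with ha
  set b : ℝ := (n : ℝ) * ((n + 1).factorial : ℝ) / 12 with hb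
  have hfac : (0 : ℝ) < n.factorial := by exact_mod_cast n.factorial_pos
  have hb0 : 0 < b := by positivity
  have hba : b < a := by
    have h : a - b = n.factorial * n * ((3 * n - 1) * (n - 2)) / 12 := by
      rw [ha, hb, Nat.cast_choose_two, Nat.factorial_succ]
      push_cast
      ring
    have : 0 < a - b := by
      rw [h]
      have h1 : (0 : ℝ) < 3 * n - 1 := by linarith
      have h2 : (0 : ℝ) < n - 2 := by linarith
      positivity
    linarith
  set T := (bordaMatrix n).mulVecLin with hT
  set S := (bordaMatrix n).transpose.mulVecLin with hS
  have hB : bordaOp n = S ∘ₗ T := bordaOp_eq_comp n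
  have hTS (v c) : (T ∘ₗ S) v c = b * v c + (a - b) / n * ∑ d, v d := by
    rw [hT, hS, ← Matrix.mulVecLin_mul, Matrix.mulVecLin_apply]
    exact bordaGram_mulVec (by omega) v c
  have hinj : Function.Injective (T ∘ₗ S) := by
    rw [← LinearMap.ker_eq_bot, LinearMap.ker_eq_bot']
    intro v hv
    refine eq_zero_of_const_add_sum (a := a) (b := b) (μ := 0) (by omega) (fun c => ?_)
      (hb0.trans hba).ne hb0.ne
    rw [← hTS, hv]
    simp
  have hSinj : Function.Injective S := Function.Injective.of_comp (f := T) hinj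
  have hTsurj : Function.Surjective T :=
    Function.Surjective.of_comp (g := S) (LinearMap.injective_iff_surjective.1 hinj)
  obtain ⟨hda, hdb⟩ := finrank_eigenspace_const_add_sum (by omega) (T ∘ₗ S) hba.ne' hTS
  rw [← finrank_eigenspace_comp_comm T S (hb0.trans hba).ne'] at hda
  rw [← finrank_eigenspace_comp_comm T S hb0.ne'] at hdb
  have hd0 : Module.finrank ℝ (Module.End.eigenspace (S ∘ₗ T : Module.End ℝ _) 0) =
      n.factorial - n := by
    have hr := T.finrank_range_add_finrank_ker
    rw [LinearMap.range_eq_top.2 hTsurj, finrank_top, Module.finrank_fin_fun,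
      Module.finrank_fintype_fun_eq_card, Fintype.card_perm, Fintype.card_fin] at hr
    rw [Module.End.eigenspace_zero,
      LinearMap.ker_comp_of_ker_eq_bot T (LinearMap.ker_eq_bot.2 hSinj)]
    omega
  have hlt : n < n.factorial := Nat.lt_factorial_self hn
  have heig {μ : ℝ} (h : 0 < Module.finrank ℝ
      (Module.End.eigenspace (S ∘ₗ T : Module.End ℝ _) μ)) :
      Module.End.HasEigenvalue (S ∘ₗ T : Module.End ℝ _) μ := by
    rw [Module.End.hasEigenvalue_iff]
    intro h'
    rw [h', finrank_bot] at h
    exact h.false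
  rw [hB]
  refine ⟨fun p q => ?_, fun μ => ⟨fun hμ => ?_, ?_⟩, hda, hdb, hd0⟩
  · change (S ∘ₗ T) p ⬝ᵥ q = p ⬝ᵥ (S ∘ₗ T) q
    simp only [hS, hT, LinearMap.comp_apply, Matrix.mulVecLin_apply, Matrix.mulVec_mulVec]
    rw [Matrix.dotProduct_mulVec, ← Matrix.mulVec_transpose]
    simp
  · obtain ⟨p, hp, hp0⟩ := hμ.exists_hasEigenvector
    rw [Module.End.mem_eigenspace_iff, LinearMap.comp_apply] at hp
    by_contra! hne
    obtain ⟨hμa, hμb, hμ0⟩ := hne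
    have hTp : T p = 0 := by
      refine eq_zero_of_const_add_sum (a := a) (b := b) (μ := μ) (by omega) (fun c => ?_) hμa hμb
      rw [← hTS, LinearMap.comp_apply, hp, map_smul]
      rfl
    rw [hTp, map_zero] at hp
    exact (smul_ne_zero hμ0 hp0) hp.symm
  · rintro (rfl | rfl | rfl)
    · exact heig (by omega)
    · exact heig (by omega)
    · exact heig (by omega)
end

section
/- Let n ≥ 2 and fix k with 1 ≤ k ≤ n − 1. Let V_k be the space of functions from the k-element subsets of Fin n to ℝ, with the Perm(Fin n)-action (σ·v)(S) = v(σ⁻¹(S)). Then the space of equivariant linear maps φ : V_k → (Fin n → ℝ), i.e., linear maps with φ(σ·v)(i) = φ(v)(σ⁻¹(i)) for all σ, v, i, has dimension exactly 2. -/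
/-- The action of a permutation σ on a function v defined on k-element subsets of
Fin n: (σ·v)(S) = v(σ⁻¹(S)). -/
def subsetAct (n k : ℕ) (σ : Equiv.Perm (Fin n))
    (v : {S : Finset (Fin n) // S.card = k} → ℝ) :
    {S : Finset (Fin n) // S.card = k} → ℝ :=
  fun S => v ⟨S.1.image ⇑σ⁻¹, by
    rw [Finset.card_image_of_injective _ (Equiv.injective σ⁻¹)]
    exact S.2⟩

/-- The space of equivariant linear maps V_k → (Fin n → ℝ). -/
noncomputable def equivariantMaps (n k : ℕ) :
    Submodule ℝ (({S : Finset (Fin n) // S.card = k} → ℝ) →ₗ[ℝ] (Fin n → ℝ)) where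
  carrier := {φ | ∀ (σ : Equiv.Perm (Fin n))
    (v : {S : Finset (Fin n) // S.card = k} → ℝ) (i : Fin n),
    φ (subsetAct n k σ v) i = φ v (σ⁻¹ i)}
  add_mem' := by
    intro φ ψ hφ hψ σ v i
    simp [hφ σ v i, hψ σ v i]
  zero_mem' := by
    intro σ v i
    simp
  smul_mem' := by
    intro a φ hφ σ v i
    simp [hφ σ v i]

/-- Any two pointed subsets of the same cardinality are related by a permutation. -/
lemma Finset.exists_perm_of_mem {α : Type*} [Fintype α] [DecidableEq α] {S T : Finset α}
    (h : S.card = T.card) {i j : α} (hi : i ∈ S) (hj : j ∈ T) :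
    ∃ σ : Equiv.Perm α, (∀ x, σ x ∈ T ↔ x ∈ S) ∧ σ i = j := by
  let e := S.equivOfCardEq h
  let f : {x // x ∈ S} ≃ {x // x ∈ T} := e.trans (Equiv.swap (e ⟨i, hi⟩) ⟨j, hj⟩)
  refine ⟨f.extendSubtype, fun x => ?_, ?_⟩
  · by_cases hx : x ∈ S
    · simpa [hx] using f.extendSubtype_mem x hx
    · simpa [hx] using f.extendSubtype_not_mem x hx
  · rw [f.extendSubtype_apply_of_mem i hi]
    simp [f]

/-- Any two subsets of the same cardinality, each with a marked point outside, are related by a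
permutation. -/
lemma Finset.exists_perm_of_notMem {α : Type*} [Fintype α] [DecidableEq α] {S T : Finset α}
    (h : S.card = T.card) {i j : α} (hi : i ∉ S) (hj : j ∉ T) :
    ∃ σ : Equiv.Perm α, (∀ x, σ x ∈ T ↔ x ∈ S) ∧ σ i = j := by
  have hc : Sᶜ.card = Tᶜ.card := by rw [Finset.card_compl, Finset.card_compl, h]
  obtain ⟨σ, hσ, hij⟩ := Finset.exists_perm_of_mem hc (i := i) (j := j) (by simpa) (by simpa)
  exact ⟨σ, fun x => by simpa [not_iff_not] using hσ x, hij⟩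

lemma subsetAct_single {n k : ℕ} {σ : Equiv.Perm (Fin n)}
    {S T : {S : Finset (Fin n) // S.card = k}} (h : ∀ x, σ x ∈ T.1 ↔ x ∈ S.1) :
    subsetAct n k σ (Pi.single S 1) = Pi.single T 1 := by
  have hT : T.1.image ⇑σ⁻¹ = S.1 := by
    ext x
    rw [← h x]
    simp [Equiv.symm_apply_eq]
  funext U
  have key : U.1.image ⇑σ⁻¹ = S.1 ↔ U = T := by
    rw [← hT, (Finset.image_injective (Equiv.injective σ⁻¹)).eq_iff, Subtype.ext_iff]
  simp only [subsetAct, Pi.single_apply, Subtype.ext_iff] at key ⊢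
  simp only [key]

lemma apply_single_eq {n k : ℕ} {φ : ({S : Finset (Fin n) // S.card = k} → ℝ) →ₗ[ℝ] (Fin n → ℝ)}
    (hφ : φ ∈ equivariantMaps n k) {σ : Equiv.Perm (Fin n)}
    {S T : {S : Finset (Fin n) // S.card = k}} (h : ∀ x, σ x ∈ T.1 ↔ x ∈ S.1) (i : Fin n) :
    φ (Pi.single T 1) (σ i) = φ (Pi.single S 1) i := by
  rw [← subsetAct_single h, hφ σ _ (σ i)]
  simp

/-- The linear map with matrix entry `p` at `(i, S)` if `i ∈ S`, and `q` otherwise. -/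
noncomputable def membershipMap (n k : ℕ) (p q : ℝ) :
    ({S : Finset (Fin n) // S.card = k} → ℝ) →ₗ[ℝ] (Fin n → ℝ) :=
  Matrix.mulVecLin (Matrix.of fun i S => if i ∈ S.1 then p else q)

lemma membershipMap_apply (n k : ℕ) (p q : ℝ) (v : {S : Finset (Fin n) // S.card = k} → ℝ)
    (i : Fin n) : membershipMap n k p q v i = ∑ S, (if i ∈ S.1 then p else q) * v S := rfl

lemma membershipMap_single (n k : ℕ) (p q : ℝ) (S : {S : Finset (Fin n) // S.card = k})
    (i : Fin n) : membershipMap n k p q (Pi.single S 1) i = if i ∈ S.1 then p else q := by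
  simp [membershipMap]

lemma membershipMap_mem (n k : ℕ) (p q : ℝ) : membershipMap n k p q ∈ equivariantMaps n k := by
  intro σ v i
  rw [membershipMap_apply, membershipMap_apply]
  let e : {S : Finset (Fin n) // S.card = k} ≃ {S : Finset (Fin n) // S.card = k} :=
    (Equiv.finsetCongr σ⁻¹).subtypeEquiv fun S => by simp
  refine Fintype.sum_equiv e _ _ fun S => ?_
  have he : (e S).1 = S.1.image ⇑σ⁻¹ := by
    simp [e, Finset.map_eq_image]
  have hmem : σ⁻¹ i ∈ (e S).1 ↔ i ∈ S.1 := by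
    rw [he, (Equiv.injective σ⁻¹).mem_finset_image]
  simp only [hmem, subsetAct]
  congr 2
  exact Subtype.ext he.symm

/-- The two kinds of matrix entries of an equivariant map. -/
def entriesMap {n k : ℕ} (T : {S : Finset (Fin n) // S.card = k}) (a b : Fin n) :
    equivariantMaps n k →ₗ[ℝ] ℝ × ℝ where
  toFun φ := (φ.1 (Pi.single T 1) a, φ.1 (Pi.single T 1) b)
  map_add' _ _ := rfl
  map_smul' _ _ := rfl

lemma entriesMap_injective {n k : ℕ} {T : {S : Finset (Fin n) // S.card = k}} {a b : Fin n}
    (ha : a ∈ T.1) (hb : b ∉ T.1) : Function.Injective (entriesMap T a b) := by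
  rw [injective_iff_map_eq_zero]
  rintro ⟨φ, hφ⟩ h
  obtain ⟨h₁, h₂⟩ := Prod.mk.inj h
  refine Subtype.ext (LinearMap.pi_ext' fun S => LinearMap.ext_ring (funext fun i => ?_))
  change φ (Pi.single S 1) i = 0
  have hc : S.1.card = T.1.card := S.2.trans T.2.symm
  by_cases hi : i ∈ S.1
  · obtain ⟨σ, hσ, rfl⟩ := Finset.exists_perm_of_mem hc hi ha
    exact (apply_single_eq hφ hσ i).symm.trans h₁
  · obtain ⟨σ, hσ, rfl⟩ := Finset.exists_perm_of_notMem hc hi hb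
    exact (apply_single_eq hφ hσ i).symm.trans h₂

lemma entriesMap_surjective {n k : ℕ} {T : {S : Finset (Fin n) // S.card = k}} {a b : Fin n}
    (ha : a ∈ T.1) (hb : b ∉ T.1) : Function.Surjective (entriesMap T a b) := fun ⟨p, q⟩ =>
  ⟨⟨membershipMap n k p q, membershipMap_mem n k p q⟩, Prod.ext
    ((membershipMap_single n k p q T a).trans (if_pos ha))
    ((membershipMap_single n k p q T b).trans (if_neg hb))⟩

/-- For 1 ≤ k ≤ n − 1, the space of equivariant linear maps
V_k → (Fin n → ℝ) has dimension exactly 2. -/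
theorem equivariantMaps_finrank (n k : ℕ) (hn : 2 ≤ n) (hk : 1 ≤ k) (hkn : k ≤ n - 1) :
    Module.finrank ℝ (equivariantMaps n k) = 2 := by
  obtain ⟨T, -, hT⟩ := Finset.exists_subset_card_eq (s := (Finset.univ : Finset (Fin n))) (n := k)
    (by simp; omega)
  obtain ⟨a, ha⟩ := Finset.card_pos.mp (hT ▸ hk)
  obtain ⟨b, hb⟩ : ∃ b, b ∉ T := by
    by_contra! h
    have := (Finset.eq_univ_iff_forall.mpr h) ▸ hT
    simp at this
    omega
  let e := LinearEquiv.ofBijective (entriesMap ⟨T, hT⟩ a b)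
    ⟨entriesMap_injective ha hb, entriesMap_surjective ha hb⟩
  rw [e.finrank_eq]
  simp
end
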